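/- Let (G,q) be a nondegenerate metric group and H a subgroup such that the restriction of the associated bimultiplicative form b to H × H is nondegenerate. Then H ∩ H^⊥ = {1}, G = H·H^⊥ (so G is the internal direct product of H and H^⊥), q(hx) = q(h)·q(x) for all h ∈ H and x ∈ H^⊥, and the restriction of b to H^⊥ × H^⊥ is also nondegenerate. -/

import Mathlib

/-- The bimultiplicative form associated to a quadratic form `q` on a group:
`b(g,h) = q(g*h) * q(g)⁻¹ * q(h)⁻¹`. -/
def metricForm {G : Type*} [Group G] (q : G → ℂˣ) (g h : G) : ℂˣ :=
  q (g * h) * (q g)⁻¹ * (q h)⁻¹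

theorem metricForm_comm {G : Type*} [CommGroup G] (q : G → ℂˣ) (g h : G) :
    metricForm q g h = metricForm q h g := by
  simp only [metricForm, mul_comm g h, mul_right_comm]

/-- The homomorphism from `G` to the dual of a subgroup `H` induced by the associated form,
when the latter is multiplicative in its first argument. -/
def metricFormHom {G : Type*} [CommGroup G] (q : G → ℂˣ)
    (hq : ∀ g₁ g₂ h : G, metricForm q (g₁ * g₂) h = metricForm q g₁ h * metricForm q g₂ h)
    (H : Subgroup G) : G →* (H →* ℂˣ) :=
  MonoidHom.mk' (fun g ↦ MonoidHom.mk' (fun h ↦ metricForm q g h) fun h₁ h₂ ↦ by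
      simp only [Subgroup.coe_mul, metricForm_comm q g, hq])
    fun g₁ g₂ ↦ MonoidHom.ext fun h ↦ hq g₁ g₂ h

/-- If the associated form is nondegenerate on `H`, every character of `H` is represented by an
element of `H`. -/
theorem metricFormHom_comp_subtype_surjective {G : Type*} [CommGroup G] [Finite G] (q : G → ℂˣ)
    (hq : ∀ g₁ g₂ h : G, metricForm q (g₁ * g₂) h = metricForm q g₁ h * metricForm q g₂ h)
    (H : Subgroup G) (hH : ∀ h ∈ H, (∀ h' ∈ H, metricForm q h h' = 1) → h = 1) :
    Function.Surjective ((metricFormHom q hq H).comp H.subtype) := by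
  have hinj : Function.Injective ((metricFormHom q hq H).comp H.subtype) := by
    refine (injective_iff_map_eq_one _).2 fun h hh ↦ Subtype.ext ?_
    exact hH h h.2 fun h' hh' ↦ DFunLike.congr_fun hh ⟨h', hh'⟩
  have hcard := CommGroup.card_monoidHom_of_hasEnoughRootsOfUnity H ℂ
  have : Finite (H →* ℂˣ) := Nat.finite_of_card_ne_zero (hcard ▸ Nat.card_pos.ne')
  exact ((Nat.bijective_iff_injective_and_card _).2 ⟨hinj, hcard.symm⟩).surjective

/-- Let `(G,q)` be a nondegenerate metric group and `H` a subgroup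
on which the associated form `b` restricts nondegenerately. Then `H ∩ H^⊥ = 1`,
`G = H · H^⊥`, `q(hx) = q(h)q(x)` for `h ∈ H`, `x ∈ H^⊥`, and the restriction of
`b` to `H^⊥` is also nondegenerate. -/
theorem nondeg_subgroup_factors_out
    {G : Type*} [CommGroup G] [Fintype G] (q : G → ℂˣ)
    (hq1 : ∀ g : G, q g⁻¹ = q g)
    (hq2 : ∀ g₁ g₂ h : G, metricForm q (g₁ * g₂) h = metricForm q g₁ h * metricForm q g₂ h)
    (hnd : ∀ g : G, (∀ h : G, metricForm q g h = 1) → g = 1)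
    (H Hperp : Subgroup G)
    (hperp : (Hperp : Set G) = {g : G | ∀ h ∈ H, metricForm q g h = 1})
    (hHnd : ∀ h ∈ H, (∀ h' ∈ H, metricForm q h h' = 1) → h = 1) :
    H ⊓ Hperp = ⊥ ∧
    (∀ g : G, ∃ h ∈ H, ∃ x ∈ Hperp, g = h * x) ∧
    (∀ h ∈ H, ∀ x ∈ Hperp, q (h * x) = q h * q x) ∧
    (∀ g ∈ Hperp, (∀ g' ∈ Hperp, metricForm q g g' = 1) → g = 1) := by
  have mem_perp (g : G) : g ∈ Hperp ↔ ∀ h ∈ H, metricForm q g h = 1 := Set.ext_iff.1 hperp g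
  have factor (g : G) : ∃ h ∈ H, ∃ x ∈ Hperp, g = h * x := by
    obtain ⟨h, hh⟩ := metricFormHom_comp_subtype_surjective q hq2 H hHnd (metricFormHom q hq2 H g)
    refine ⟨h, h.2, (h : G)⁻¹ * g, (mem_perp _).2 fun h' hh' ↦ ?_, (mul_inv_cancel_left _ _).symm⟩
    have hker : metricFormHom q hq2 H ((h : G)⁻¹ * g) = 1 := by
      rw [map_mul, map_inv, ← hh]
      exact inv_mul_cancel _
    exact DFunLike.congr_fun hker ⟨h', hh'⟩
  refine ⟨?_, factor, fun h hh x hx ↦ ?_, fun g hg hg' ↦ hnd g fun k ↦ ?_⟩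
  · exact (Subgroup.eq_bot_iff_forall _).2 fun h hh ↦ hHnd h hh.1 ((mem_perp h).1 hh.2)
  · have hb : metricForm q h x = 1 := metricForm_comm q h x ▸ (mem_perp x).1 hx h hh
    rw [metricForm, mul_inv_eq_one, mul_inv_eq_iff_eq_mul] at hb
    rw [hb, mul_comm]
  · obtain ⟨h, hh, x, hx, rfl⟩ := factor k
    rw [metricForm_comm, hq2, metricForm_comm q h, metricForm_comm q x, (mem_perp g).1 hg h hh,
      hg' x hx, one_mul]
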